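/- Let n ≥ 3, let B be a D-admissible subset of [±n] with |B| = n, let k and l be distinct elements of B, and set A = B ∖ {k, l}. Then τ_A·τ_B² = 0 in R^D_n. -/

import Mathlib

open MvPolynomial

/-- The set `[±n]`, realized as `Fin n × Bool`: `(k, true) ↔ k+1` and `(k, false) ↔ −(k+1)`. -/
abbrev PM (n : ℕ) := Fin n × Bool

/-- Negation on `[±n]`. -/
def negPM {n : ℕ} (p : PM n) : PM n := (p.1, !p.2)

/-- A subset `S ⊆ [±n]` is D-admissible if it is nonempty, contains no pair `{i, −i}`,
and `|S| ≠ n − 1`. -/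
def DAdm (n : ℕ) (S : Finset (PM n)) : Prop :=
  S.Nonempty ∧ (∀ p ∈ S, negPM p ∉ S) ∧ S.card ≠ n - 1

instance (n : ℕ) (S : Finset (PM n)) : Decidable (DAdm n S) := by unfold DAdm; infer_instance

/-- Two D-admissible sets are compatible if `S ⊆ T`, or `T ⊆ S`, or `|S| = |T| = n` and
`|S ∩ T| = n − 1`. -/
def Compat (n : ℕ) (S T : Finset (PM n)) : Prop :=
  S ⊆ T ∨ T ⊆ S ∨ (S.card = n ∧ T.card = n ∧ (S ∩ T).card = n - 1)

instance (n : ℕ) (S T : Finset (PM n)) : Decidable (Compat n S T) := by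
  unfold Compat; infer_instance

/-- Index type of the variables: the D-admissible subsets of `[±n]`. -/
abbrev IdxD (n : ℕ) := {S : Finset (PM n) // DAdm n S}

/-- `ε_k(S) = 1` if `k ∈ S`, `−1` if `−k ∈ S`, and `0` otherwise. -/
def eps (n : ℕ) (k : Fin n) (S : Finset (PM n)) : ℤ :=
  if (k, true) ∈ S then 1 else if (k, false) ∈ S then -1 else 0

/-- Generators of the defining ideal of `R^D_n`: (i) products `τ_S τ_T` for incompatible `S, T`;
(ii) for `k ≠ l` and each sign `e = ±1`,
`Σ_{|S|≤n−2} (ε_k(S) − e·ε_l(S)) τ_S + Σ_{|S|=n} ((ε_k(S) − e·ε_l(S))/2) τ_S`. -/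
def relD (n : ℕ) : Set (MvPolynomial (IdxD n) ℤ) :=
  {p | ∃ S T : IdxD n, ¬ Compat n S.1 T.1 ∧ p = X S * X T} ∪
  {p | ∃ k l : Fin n, ∃ e : ℤ, (e = 1 ∨ e = -1) ∧ k ≠ l ∧ p =
      (∑ S : IdxD n, if S.1.card ≤ n - 2 then C (eps n k S.1 - e * eps n l S.1) * X S else 0) +
      (∑ S : IdxD n, if S.1.card = n then C ((eps n k S.1 - e * eps n l S.1) / 2) * X S else 0)}

/-- The ring `R^D_n`. -/
abbrev RD (n : ℕ) := MvPolynomial (IdxD n) ℤ ⧸ Ideal.span (relD n)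

/-- The class `τ_S ∈ R^D_n` of a D-admissible subset `S ⊆ [±n]`. -/
noncomputable def tauD (n : ℕ) (S : Finset (PM n)) : RD n :=
  if h : DAdm n S then Ideal.Quotient.mk _ (X (⟨S, h⟩ : IdxD n)) else 1

/-- The subset `{1,…,i}` of `[±n]`. -/
def initSegD (n i : ℕ) : Finset (PM n) :=
  Finset.univ.filter (fun p : PM n => p.2 = true ∧ (p.1 : ℕ) < i)

/-- The subset `[n]_+ = {1,…,n−1,n}` of `[±n]`. -/
def fullPlus (n : ℕ) : Finset (PM n) :=
  Finset.univ.filter (fun p : PM n => p.2 = true)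

/-- The subset `[n]_− = {1,…,n−1,−n}` of `[±n]`. -/
def fullMinus (n : ℕ) : Finset (PM n) :=
  Finset.univ.filter (fun p : PM n =>
    (p.2 = true ∧ (p.1 : ℕ) < n - 1) ∨ (p.2 = false ∧ (p.1 : ℕ) = n - 1))

/-- The class of a point: `τ_{{1}} ⋯ τ_{{1,…,n−2}} · τ_{[n]_+} · τ_{[n]_−}`. -/
noncomputable def ptD (n : ℕ) : RD n :=
  (∏ i ∈ Finset.Icc 1 (n - 2), tauD n (initSegD n i)) * tauD n (fullPlus n) *
    tauD n (fullMinus n)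

/-- The number of negative entries of `S ⊆ [±n]`. -/
def negCount {n : ℕ} (S : Finset (PM n)) : ℕ := (S.filter (fun p => p.2 = false)).card

/-- The sign of an element of `[±n]`. -/
def signPM {n : ℕ} (p : PM n) : ℤ := if p.2 = true then 1 else -1

lemma eps_of_mem {n : ℕ} {S : Finset (PM n)} (hS : DAdm n S) {p : PM n} (hp : p ∈ S) :
    eps n p.1 S = signPM p := by
  have h := hS.2.1 p hp
  rcases p with ⟨a, _ | _⟩ <;> simp_all [eps, signPM, negPM]

lemma eps_of_negPM_mem {n : ℕ} {S : Finset (PM n)} (hS : DAdm n S) {p : PM n}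
    (hp : negPM p ∈ S) : eps n p.1 S = -signPM p := by
  have h := eps_of_mem hS hp
  rcases p with ⟨a, _ | _⟩ <;> simpa [signPM, negPM] using h

lemma eps_eq_zero {n : ℕ} {S : Finset (PM n)} {p : PM n} (hp : p ∉ S) (hp' : negPM p ∉ S) :
    eps n p.1 S = 0 := by
  rcases p with ⟨a, _ | _⟩ <;> simp_all [eps, negPM]

lemma eq_or_eq_negPM {n : ℕ} {p q : PM n} (h : p.1 = q.1) : p = q ∨ p = negPM q := by
  rcases p with ⟨a, _ | _⟩ <;> rcases q with ⟨b, _ | _⟩ <;> simp_all [negPM]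

lemma DAdm.fst_ne {n : ℕ} {S : Finset (PM n)} (hS : DAdm n S) {p q : PM n} (hp : p ∈ S)
    (hq : q ∈ S) (hpq : p ≠ q) : p.1 ≠ q.1 := by
  intro h
  rcases eq_or_eq_negPM h with h | h
  · exact hpq h
  · exact hS.2.1 q hq (h ▸ hp)

/-- A maximal D-admissible set contains one of `p` and `-p` for every `p`. -/
lemma DAdm.mem_or_negPM_mem {n : ℕ} {S : Finset (PM n)} (hS : DAdm n S) (hc : S.card = n)
    (p : PM n) : p ∈ S ∨ negPM p ∈ S := by
  have himg : S.image Prod.fst = Finset.univ := by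
    apply Finset.eq_univ_of_card
    rw [Finset.card_image_of_injOn, hc, Fintype.card_fin]
    intro x hx y hy hxy
    by_contra hne
    exact hS.fst_ne hx hy hne hxy
  have hp : p.1 ∈ S.image Prod.fst := himg ▸ Finset.mem_univ _
  obtain ⟨q, hq, hqp⟩ := Finset.mem_image.mp hp
  rcases eq_or_eq_negPM hqp with rfl | rfl
  · exact Or.inl hq
  · exact Or.inr hq

lemma tauD_mul_eq_zero {n : ℕ} {S T : Finset (PM n)} (hS : DAdm n S) (hT : DAdm n T)
    (h : ¬ Compat n S T) : tauD n S * tauD n T = 0 := by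
  rw [tauD, tauD, dif_pos hS, dif_pos hT, ← map_mul, Ideal.Quotient.eq_zero_iff_mem]
  exact Ideal.subset_span (Or.inl ⟨⟨S, hS⟩, ⟨T, hT⟩, h, rfl⟩)

/-- The defining linear relations, in the quotient ring. -/
lemma linear_relation (n : ℕ) {a b : Fin n} (hab : a ≠ b) {e : ℤ} (he : e = 1 ∨ e = -1) :
    ∑ S : IdxD n,
      (((if S.1.card ≤ n - 2 then eps n a S.1 - e * eps n b S.1 else 0) +
        (if S.1.card = n then (eps n a S.1 - e * eps n b S.1) / 2 else 0) : ℤ) : RD n) *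
        tauD n S.1 = 0 := by
  have h := Ideal.Quotient.eq_zero_iff_mem.mpr
    (Ideal.subset_span (s := relD n) (Or.inr ⟨a, b, e, he, hab, rfl⟩))
  rw [← Finset.sum_add_distrib, map_sum] at h
  rw [← h]
  refine Finset.sum_congr rfl fun S _ => ?_
  have hC (z : ℤ) : (C z : MvPolynomial (IdxD n) ℤ) = (z : MvPolynomial (IdxD n) ℤ) :=
    eq_intCast C z
  rw [tauD, dif_pos S.2, ← map_intCast (Ideal.Quotient.mk (Ideal.span (relD n))), ← map_mul]
  congr 1
  split_ifs <;> (simp [hC]; try ring)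

/-- The coefficient of a maximal set adjacent to `B` in the linear relation attached to
`k, l ∈ B` vanishes when the set contains `B ∖ {k, l}`. -/
lemma eps_coeff_eq_zero_of_adjacent {n : ℕ} {B S : Finset (PM n)} (hcard : B.card = n)
    {k l : PM n} (hk : k ∈ B) (hl : l ∈ B) (hkl : k ≠ l) (hS : DAdm n S) (hSn : S.card = n)
    (hAS : B \ {k, l} ⊆ S) (hSB : (S ∩ B).card = n - 1) :
    eps n k.1 S - -(signPM k * signPM l) * eps n l.1 S = 0 := by
  have hn : 0 < n := hcard ▸ Finset.card_pos.mpr ⟨k, hk⟩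
  have hdiff : (B \ S).card = 1 := by
    have := Finset.card_sdiff_add_card_inter B S
    rw [Finset.inter_comm] at this
    omega
  obtain ⟨x, hx⟩ := Finset.card_eq_one.mp hdiff
  have hmem (y : PM n) : y ∈ B ∧ y ∉ S ↔ y = x := by
    rw [← Finset.mem_sdiff, hx, Finset.mem_singleton]
  have hxB := (hmem x).mpr rfl
  have hsq (p : PM n) : signPM p * signPM p = 1 := by
    rcases p with ⟨a, _ | _⟩ <;> simp [signPM]
  have hxkl : x = k ∨ x = l := by
    by_contra! hne
    exact hxB.2 (hAS (by simp [hxB.1, hne]))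
  rcases hxkl with rfl | rfl
  · have hlS : l ∈ S := by
      by_contra h
      exact hkl ((hmem l).mp ⟨hl, h⟩).symm
    rw [eps_of_negPM_mem hS ((hS.mem_or_negPM_mem hSn x).resolve_left hxB.2), eps_of_mem hS hlS]
    linear_combination signPM x * hsq l
  · have hkS : k ∈ S := by
      by_contra h
      exact hkl ((hmem k).mp ⟨hk, h⟩)
    rw [eps_of_negPM_mem hS ((hS.mem_or_negPM_mem hSn x).resolve_left hxB.2), eps_of_mem hS hkS]
    linear_combination -signPM k * hsq x

/-- For `n ≥ 3`, a D-admissible `B ⊆ [±n]` with `|B| = n`, distinct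
`k, l ∈ B`, and `A = B ∖ {k, l}`, one has `τ_A τ_B² = 0` in `R^D_n`. -/
theorem typeD_square_vanishing (n : ℕ) (hn : 3 ≤ n)
    (B : Finset (PM n)) (hB : DAdm n B) (hcard : B.card = n)
    (k l : PM n) (hk : k ∈ B) (hl : l ∈ B) (hkl : k ≠ l) :
    tauD n (B \ {k, l}) * tauD n B ^ 2 = 0 := by
  set A := B \ {k, l} with hA
  have hAB : A ⊆ B := Finset.sdiff_subset
  have hAcard : A.card = n - 2 := by
    rw [hA, Finset.card_sdiff_of_subset (by simp [Finset.insert_subset_iff, hk, hl]), hcard,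
      Finset.card_pair hkl]
  have hAadm : DAdm n A :=
    ⟨Finset.card_pos.mp (by omega), fun p hp h => hB.2.1 p (hAB hp) (hAB h), by omega⟩
  have he : -(signPM k * signPM l) = 1 ∨ -(signPM k * signPM l) = -1 := by
    unfold signPM; split_ifs <;> simp
  have hrel := linear_relation n (hB.fst_ne hk hl hkl) he
  have hprod := congrArg (fun x => x * (tauD n A * tauD n B)) hrel
  simp only [Finset.sum_mul, zero_mul] at hprod
  rw [Finset.sum_eq_single (⟨B, hB⟩ : IdxD n)] at hprod
  · have hcoef : (eps n k.1 B - -(signPM k * signPM l) * eps n l.1 B) / 2 = signPM k := by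
      rw [eps_of_mem hB hk, eps_of_mem hB hl]
      unfold signPM; split_ifs <;> norm_num
    rw [if_neg (by simp only; omega), if_pos hcard, hcoef, zero_add] at hprod
    have hunit : ((signPM k : ℤ) : RD n) * (signPM k : ℤ) = 1 := by
      unfold signPM; split_ifs <;> push_cast <;> ring
    linear_combination ((signPM k : ℤ) : RD n) * hprod - tauD n A * tauD n B ^ 2 * hunit
  · rintro ⟨S, hS⟩ - hSB
    replace hSB : S ≠ B := fun h => hSB (Subtype.ext h)
    simp only
    by_cases h1 : Compat n S A
    swap
    · linear_combination (_ * tauD n B) * tauD_mul_eq_zero hS hAadm h1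
    by_cases h2 : Compat n S B
    swap
    · linear_combination (_ * tauD n A) * tauD_mul_eq_zero hS hB h2
    suffices hz : ((if S.card ≤ n - 2 then
        eps n k.1 S - -(signPM k * signPM l) * eps n l.1 S else 0) +
        (if S.card = n then (eps n k.1 S - -(signPM k * signPM l) * eps n l.1 S) / 2 else 0) : ℤ)
        = 0 by
      rw [hz]; simp
    by_cases hSn : S.card = n
    · have hAS : A ⊆ S := by
        rcases h1 with h | h | h
        · have := Finset.card_le_card h; omega
        · exact h
        · omega
      have hadj : (S ∩ B).card = n - 1 := by
        rcases h2 with h | h | h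
        · exact absurd (Finset.eq_of_subset_of_card_le h (by omega)) hSB
        · exact absurd (Finset.eq_of_subset_of_card_le h (by omega)).symm hSB
        · exact h.2.2
      rw [eps_coeff_eq_zero_of_adjacent hcard hk hl hkl hS hSn hAS hadj]
      simp
    · rw [if_neg hSn, add_zero]
      split_ifs with hle
      · have hSA : S ⊆ A := by
          rcases h1 with h | h | h
          · exact h
          · exact (Finset.eq_of_subset_of_card_le h (by omega)).ge
          · omega
        rw [eps_eq_zero (p := k) (fun h => by simpa [hA] using hSA h)
            (fun h => hB.2.1 k hk (hAB (hSA h))),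
          eps_eq_zero (p := l) (fun h => by simpa [hA] using hSA h)
            (fun h => hB.2.1 l hl (hAB (hSA h)))]
        simp
      · rfl
  · intro h; exact absurd (Finset.mem_univ _) h
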